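/- Let n > 2 be an integer and let G be a graph cospectral with the friendship graph F_n. Then the complement of G is either connected, or it is the disjoint union of a single isolated vertex (K_1) and a connected graph on 2n vertices. -/

import Mathlib

open Polynomial

/-- The adjacency matrix of a simple graph, with entries in `R`. -/
noncomputable def adjMat (R : Type*) [Zero R] [One R] {V : Type*} [Fintype V]
    (G : SimpleGraph V) : Matrix V V R :=
  letI := Classical.decRel G.Adj
  G.adjMatrix R

/-- The friendship graph `F n`: `n` triangles glued at the common vertex `none`. -/
def friendshipGraph (n : ℕ) : SimpleGraph (Option (Fin n × Bool)) :=
  SimpleGraph.fromRel (fun u v =>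
    u = none ∨ ∃ i : Fin n, u = some (i, true) ∧ v = some (i, false))

/-- Two finite graphs are cospectral if their real adjacency matrices have the same
characteristic polynomial. -/
def Cospectral {V W : Type*} [Fintype V] [Fintype W] [DecidableEq V] [DecidableEq W]
    (G : SimpleGraph V) (H : SimpleGraph W) : Prop :=
  (adjMat ℝ G).charpoly = (adjMat ℝ H).charpoly

/-- The trace of the square of a real symmetric matrix is the sum of the squares of the roots
of its characteristic polynomial. -/
theorem Matrix.IsHermitian.trace_mul_self_eq_sum_roots_sq {V : Type*} [Fintype V] [DecidableEq V]
    {A : Matrix V V ℝ} (hA : A.IsHermitian) :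
    (A * A).trace = (A.charpoly.roots.map (fun x => x ^ 2)).sum := by
  rw [hA.roots_charpoly_eq_eigenvalues]
  conv_lhs => rw [hA.spectral_theorem, ← map_mul, Unitary.conjStarAlgAut_apply,
    Matrix.trace_mul_cycle]
  simp [Matrix.diagonal_mul_diagonal, Matrix.trace_diagonal, pow_two]

open Classical in
theorem adjMat_apply {V : Type*} [Fintype V] (G : SimpleGraph V) (u v : V) :
    adjMat ℝ G u v = if G.Adj u v then 1 else 0 := by
  simp [adjMat, SimpleGraph.adjMatrix_apply]

theorem adjMat_isHermitian {V : Type*} [Fintype V] (G : SimpleGraph V) :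
    (adjMat ℝ G).IsHermitian := by
  classical
  ext u v
  simpa [adjMat_apply] using if_congr (G.adj_comm v u) rfl rfl

theorem trace_adjMat_mul_self {V : Type*} [Fintype V] (G : SimpleGraph V) :
    (adjMat ℝ G * adjMat ℝ G).trace = ∑ u, ∑ v, adjMat ℝ G u v := by
  simp only [Matrix.trace, Matrix.diag, Matrix.mul_apply]
  refine Finset.sum_congr rfl fun u _ => Finset.sum_congr rfl fun v _ => ?_
  simp [adjMat_apply, G.adj_comm v u]

theorem Cospectral.card_eq {V W : Type*} [Fintype V] [Fintype W] [DecidableEq V] [DecidableEq W]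
    {G : SimpleGraph V} {H : SimpleGraph W} (h : Cospectral G H) :
    Fintype.card V = Fintype.card W := by
  rw [← (adjMat ℝ G).charpoly_natDegree_eq_dim, ← (adjMat ℝ H).charpoly_natDegree_eq_dim]
  exact congrArg natDegree h

/-- Cospectral graphs have the same number of darts. -/
theorem Cospectral.sum_adjMat_eq {V W : Type*} [Fintype V] [Fintype W] [DecidableEq V]
    [DecidableEq W] {G : SimpleGraph V} {H : SimpleGraph W} (h : Cospectral G H) :
    ∑ u, ∑ v, adjMat ℝ G u v = ∑ u, ∑ v, adjMat ℝ H u v := by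
  rw [← trace_adjMat_mul_self, ← trace_adjMat_mul_self,
    (adjMat_isHermitian G).trace_mul_self_eq_sum_roots_sq,
    (adjMat_isHermitian H).trace_mul_self_eq_sum_roots_sq, show _ = _ from h]

theorem sum_adjMat_friendshipGraph (n : ℕ) :
    ∑ u, ∑ v, adjMat ℝ (friendshipGraph n) u v = 6 * n := by
  have h₁ (x : Fin n × Bool) : (friendshipGraph n).Adj none (some x) := by
    simp [friendshipGraph]
  simp only [adjMat_apply, Fintype.sum_option, h₁, (h₁ _).symm, SimpleGraph.irrefl, if_true,
    if_false, Finset.sum_add_distrib]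
  have h₂ (x y : Fin n × Bool) :
      (friendshipGraph n).Adj (some x) (some y) ↔ y = (x.1, !x.2) := by
    obtain ⟨i, b⟩ := x
    obtain ⟨j, c⟩ := y
    cases b <;> cases c <;> simp [friendshipGraph, eq_comm]
  simp [h₂]
  ring

/-- If no edge of the complement of `G` joins `S` to the rest, then `G` has all possible darts
between `S` and the rest. -/
theorem two_mul_card_mul_card_le_sum_adjMat {V : Type*} [Fintype V] [DecidableEq V]
    (G : SimpleGraph V) (S : Finset V) (hS : ∀ u ∈ S, ∀ v ∉ S, ¬ Gᶜ.Adj u v) :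
    (2 * S.card * Sᶜ.card : ℝ) ≤ ∑ u, ∑ v, adjMat ℝ G u v := by
  have hadj : ∀ u ∈ S, ∀ v ∈ Sᶜ, G.Adj u v := by
    intro u hu v hv
    rw [Finset.mem_compl] at hv
    have := hS u hu v hv
    rw [SimpleGraph.compl_adj] at this
    by_contra hG
    exact this ⟨fun e => hv (e ▸ hu), hG⟩
  have hnn (u v : V) : 0 ≤ adjMat ℝ G u v := by
    rw [adjMat_apply]; split_ifs <;> norm_num
  have hle (s t : Finset V) (hst : ∀ u ∈ s, ∀ v ∈ t, G.Adj u v) :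
      (s.card * t.card : ℝ) ≤ ∑ u ∈ s, ∑ v, adjMat ℝ G u v := by
    calc (s.card * t.card : ℝ) = ∑ u ∈ s, ∑ v ∈ t, adjMat ℝ G u v := by
          rw [Finset.sum_congr rfl fun u hu => Finset.sum_congr rfl fun v hv =>
            (adjMat_apply G u v).trans (if_pos (hst u hu v hv))]
          simp
      _ ≤ _ := Finset.sum_le_sum fun u _ =>
          Finset.sum_le_sum_of_subset_of_nonneg t.subset_univ fun v _ _ => hnn u v
  have h₁ := hle S Sᶜ hadj
  have h₂ := hle Sᶜ S fun u hu v hv => (hadj v hv u hu).symm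
  rw [← Finset.sum_add_sum_compl S]
  linarith

/-- The vertices of a disconnected graph split into two nonempty parts with no edge between them. -/
theorem SimpleGraph.exists_separating_set_of_not_connected {V : Type*} [Nonempty V]
    {H : SimpleGraph V} (hH : ¬ H.Connected) :
    ∃ S : Set V, S.Nonempty ∧ Sᶜ.Nonempty ∧ ∀ u ∈ S, ∀ v ∉ S, ¬ H.Adj u v := by
  have : ¬ H.Preconnected := fun h => hH ⟨h⟩
  simp only [SimpleGraph.Preconnected, not_forall] at this
  obtain ⟨a, b, hab⟩ := this
  exact ⟨{x | H.Reachable a x}, ⟨a, SimpleGraph.Reachable.refl a⟩, ⟨b, hab⟩,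
    fun u hu v hv huv => hv (SimpleGraph.Reachable.trans hu huv.reachable)⟩

theorem Cospectral.card_eq_one_or_card_compl_eq_one {V : Type*} [Fintype V] [DecidableEq V]
    {n : ℕ} (hn : 2 < n) {G : SimpleGraph V} (hG : Cospectral G (friendshipGraph n))
    {S : Finset V} (hne : S.Nonempty) (hne' : Sᶜ.Nonempty)
    (hS : ∀ u ∈ S, ∀ v ∉ S, ¬ Gᶜ.Adj u v) : S.card = 1 ∨ Sᶜ.card = 1 := by
  have hle := two_mul_card_mul_card_le_sum_adjMat G S hS
  rw [hG.sum_adjMat_eq, sum_adjMat_friendshipGraph] at hle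
  have hle' : 2 * S.card * Sᶜ.card ≤ 6 * n := by exact_mod_cast hle
  have hcard : S.card + Sᶜ.card = 2 * n + 1 := by
    rw [Finset.card_add_card_compl, hG.card_eq]
    simp [mul_comm]
  have h₁ := hne.card_pos
  have h₂ := hne'.card_pos
  by_contra! h
  obtain ⟨a, ha⟩ : ∃ a, S.card = a + 2 := ⟨S.card - 2, by omega⟩
  obtain ⟨b, hb⟩ : ∃ b, Sᶜ.card = b + 2 := ⟨Sᶜ.card - 2, by omega⟩
  rw [ha, hb] at hle' hcard
  nlinarith [Nat.zero_le (a * b)]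

/-- for `n > 2`, if `G` is cospectral with the friendship graph `F n`, then
the complement of `G` is either connected, or it is the disjoint union of a single isolated
vertex and a connected graph on `2n` vertices. -/
theorem complement_connected_or_isolated_vertex
    {V : Type*} [Fintype V] [DecidableEq V]
    (n : ℕ) (hn : 2 < n) (G : SimpleGraph V)
    (hG : Cospectral G (friendshipGraph n)) :
    Gᶜ.Connected ∨ ∃ v : V, (∀ w : V, ¬ Gᶜ.Adj v w) ∧
      (Gᶜ.induce {v}ᶜ).Connected ∧ Nat.card ({v}ᶜ : Set V) = 2 * n := by
  classical
  have hcard : Fintype.card V = 2 * n + 1 := by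
    rw [hG.card_eq]
    simp [mul_comm]
  have : Nonempty V := Fintype.card_pos_iff.mp (by omega)
  rw [or_iff_not_imp_left]
  intro hconn
  obtain ⟨v, hv⟩ : ∃ v : V, ∀ w : V, ¬ Gᶜ.Adj v w := by
    obtain ⟨S, hne, hne', hS⟩ := SimpleGraph.exists_separating_set_of_not_connected hconn
    rcases hG.card_eq_one_or_card_compl_eq_one hn (S := S.toFinset) (by simpa using hne)
      (by simpa [← Set.toFinset_compl] using hne') (by simpa using hS) with h | h
    · obtain ⟨v, hv⟩ := Finset.card_eq_one.mp h
      have hmem (x : V) : x ∈ S ↔ x = v := by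
        rw [← Set.mem_toFinset, hv, Finset.mem_singleton]
      refine ⟨v, fun w hw => hS v ((hmem v).2 rfl) w (fun h => ?_) hw⟩
      exact hw.ne ((hmem w).1 h).symm
    · obtain ⟨v, hv⟩ := Finset.card_eq_one.mp h
      have hmem (x : V) : x ∉ S ↔ x = v := by
        rw [← Set.mem_toFinset, ← Finset.mem_compl, hv, Finset.mem_singleton]
      refine ⟨v, fun w hw => hS w ?_ v ((hmem v).2 rfl) hw.symm⟩
      by_contra h
      exact hw.ne ((hmem w).1 h).symm
  have hcompl : Nat.card ({v}ᶜ : Set V) = 2 * n := by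
    rw [Nat.card_eq_fintype_card, Fintype.card_compl_set, hcard]
    simp
  refine ⟨v, hv, ?_, hcompl⟩
  have : Nonempty ({v}ᶜ : Set V) := (Nat.card_pos_iff.mp (by omega)).1
  by_contra hdisc
  obtain ⟨S, ⟨a, ha⟩, ⟨b, hb⟩, hS⟩ :=
    SimpleGraph.exists_separating_set_of_not_connected hdisc
  -- With `v` added to its complement, each side separates the whole complement graph.
  have key (T : Set ({v}ᶜ : Set V)) (hT : T.Nonempty) (hT' : Tᶜ.Nonempty)
      (hsep : ∀ x ∈ T, ∀ y ∉ T, ¬ (Gᶜ.induce {v}ᶜ).Adj x y) : T.ncard = 1 := by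
    obtain ⟨x, hx⟩ := hT
    obtain ⟨y, hy⟩ := hT'
    set F : Finset V := T.toFinset.map (Function.Embedding.subtype _) with hF
    have hmem (u : V) : u ∈ F ↔ ∃ h : u ∈ ({v}ᶜ : Set V), (⟨u, h⟩ : ({v}ᶜ : Set V)) ∈ T := by
      simp [hF]
    have hvF : v ∈ Fᶜ := by simp [hmem]
    have hyF : (y : V) ∈ Fᶜ := by
      rw [Finset.mem_compl, hmem]
      exact fun ⟨_, h⟩ => hy h
    have hFsep : ∀ u ∈ F, ∀ w ∉ F, ¬ Gᶜ.Adj u w := by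
      intro u hu w hw huw
      obtain ⟨hu₁, hu₂⟩ := (hmem u).1 hu
      have hwv : w ∈ ({v}ᶜ : Set V) := by
        rintro rfl
        exact hv u huw.symm
      exact hsep _ hu₂ ⟨w, hwv⟩ (fun h => hw ((hmem w).2 ⟨hwv, h⟩)) huw
    have hFcard : F.card = T.ncard := by
      rw [hF, Finset.card_map, Set.ncard_eq_toFinset_card']
    rcases hG.card_eq_one_or_card_compl_eq_one hn ⟨x, (hmem x).2 ⟨x.2, hx⟩⟩ ⟨v, hvF⟩ hFsep
      with h | h
    · exact hFcard ▸ h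
    · exact absurd (Finset.card_le_one.1 h.le _ hyF _ hvF) y.2
  have h₁ := key S ⟨a, ha⟩ ⟨b, hb⟩ hS
  have h₂ := key Sᶜ ⟨b, hb⟩ ⟨a, by simpa using ha⟩
    fun x hx y hy hxy => hS y (by simpa using hy) x hx hxy.symm
  have h₃ := Set.ncard_add_ncard_compl S
  omega
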